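/- Let G be a nonempty directed multigraph, and let N(el(G)) be the nerve of its category of elements (over the category V ⇉ E). Then N(el(G)) is weakly contractible if and only if the underlying undirected graph of G is a tree (simple, connected, acyclic) and G has no loops or multiple edges. -/

import Mathlib

open CategoryTheory CategoryTheory.Limits Opposite Topology

/-- A simplicial set is weakly contractible if its geometric realization is nonempty
and all of its homotopy groups (at every basepoint, `π₀` included) are trivial. -/
def WeaklyContractible (X : SSet.{0}) : Prop :=
  Nonempty (SSet.toTop.obj X) ∧
    ∀ (n : ℕ) (x : SSet.toTop.obj X), Subsingleton (π_ n (SSet.toTop.obj X) x)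

open scoped unitInterval Topology.Homotopy Simplicial

/-- stretching map -/
noncomputable def stretchI (t : I) : I := Set.projIcc 0 1 zero_le_one (2 * (t : ℝ) - 1/2)
noncomputable def bumpI (t : I) : I :=
  Set.projIcc 0 1 zero_le_one (4 * min (t : ℝ) (1 - t))

lemma continuous_stretchI : Continuous stretchI := by
  unfold stretchI; fun_prop
lemma continuous_bumpI : Continuous bumpI := by
  unfold bumpI; fun_prop
lemma stretchI_zero : stretchI 0 = 0 := by
  apply Set.projIcc_of_le_left; norm_num
lemma stretchI_one : stretchI 1 = 1 := by
  apply Set.projIcc_of_right_le; norm_num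
lemma bumpI_zero : bumpI 0 = 0 := by
  apply Set.projIcc_of_le_left; norm_num
lemma bumpI_one : bumpI 1 = 0 := by
  apply Set.projIcc_of_le_left; norm_num
lemma stretchI_of_bumpI (t : I) (h : bumpI t ≠ 1) : stretchI t = 0 ∨ stretchI t = 1 := by
  by_cases h1 : (t : ℝ) ≤ 1/4
  · left; apply Set.projIcc_of_le_left; linarith
  by_cases h2 : (3/4 : ℝ) ≤ t
  · right; apply Set.projIcc_of_right_le; linarith
  exact absurd (Set.projIcc_of_right_le _ (by
    push Not at h1 h2
    have : (1/4 : ℝ) ≤ min (t : ℝ) (1 - t) := le_min h1.le (by linarith)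
    linarith)) h

noncomputable def mixI (s a b : I) : I :=
  ⟨(1 - (s:ℝ)) * a + s * b, by
    have := s.2.1; have := s.2.2; have := a.2.1; have := a.2.2; have := b.2.1; have := b.2.2
    constructor
    · nlinarith [mul_nonneg (sub_nonneg.2 s.2.2) a.2.1, mul_nonneg s.2.1 b.2.1]
    · nlinarith [mul_nonneg (sub_nonneg.2 s.2.2) (sub_nonneg.2 a.2.2), mul_nonneg s.2.1 (sub_nonneg.2 b.2.2)]⟩

lemma mixI_same (s a : I) : mixI s a a = a := by
  ext; simp only [mixI]; ring

lemma mixI_zero (a b : I) : mixI 0 a b = a := by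
  ext; simp [mixI]
lemma mixI_one (a b : I) : mixI 1 a b = b := by
  ext; simp [mixI]

theorem subsingleton_homotopyGroup {Y : Type*} [TopologicalSpace Y] (c : Y → I → Y)
    (hc : Continuous fun p : Y × I => c p.1 p.2) (r : Y) (h0 : ∀ y, c y 0 = r)
    (h1 : ∀ y, c y 1 = y) (n : ℕ) (x : Y) : Subsingleton (π_ n Y x) := by
  let d : (Fin n → I) → I := fun u => σ (∏ i, bumpI (u i))
  have hd : Continuous d := by
    have := continuous_bumpI
    exact unitInterval.continuous_symm.comp (by fun_prop)
  have hdb : ∀ u ∈ Cube.boundary (Fin n), d u = 1 := by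
    rintro u ⟨i, hi⟩
    have : ∏ i, bumpI (u i) = 0 := by
      apply Finset.prod_eq_zero (Finset.mem_univ i)
      rcases hi with hi | hi <;> rw [hi]
      exacts [bumpI_zero, bumpI_one]
    simp [d, this]
  let ρ : (Fin n → I) → (Fin n → I) := fun u i => stretchI (u i)
  have hρ : Continuous ρ := by
    have := continuous_stretchI
    fun_prop
  have hρb : ∀ u ∈ Cube.boundary (Fin n), ρ u ∈ Cube.boundary (Fin n) := by
    rintro u ⟨i, hi⟩
    refine ⟨i, ?_⟩
    rcases hi with hi | hi
    · left; simp [ρ, hi, stretchI_zero]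
    · right; simp [ρ, hi, stretchI_one]
  have hρd : ∀ u, d u ≠ 0 → ρ u ∈ Cube.boundary (Fin n) := by
    intro u hu
    by_contra hcon
    apply hu
    have : ∏ i, bumpI (u i) = 1 := by
      apply Finset.prod_eq_one
      intro i _
      by_contra h
      exact hcon ⟨i, stretchI_of_bumpI _ h⟩
    simp [d, this]
  let K : GenLoop (Fin n) Y x := ⟨⟨fun u => c x (d u), hc.comp (continuous_const.prodMk hd)⟩, by
    intro u hu
    show c x (d u) = x
    rw [hdb u hu, h1]⟩
  have key : ∀ f : GenLoop (Fin n) Y x, GenLoop.Homotopic f K := by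
    intro f
    have hfc : Continuous f := f.1.continuous
    let M : GenLoop (Fin n) Y x := ⟨⟨fun u => f (ρ u), hfc.comp hρ⟩, by
      intro u hu
      exact f.2 _ (hρb u hu)⟩
    have e1 : GenLoop.Homotopic f M := by
      refine ⟨⟨⟨⟨fun p => f (fun i => mixI p.1 (p.2 i) (ρ p.2 i)), ?_⟩, ?_, ?_⟩, ?_⟩⟩
      · refine hfc.comp (continuous_pi fun i => ?_)
        apply Continuous.subtype_mk
        have h2 : Continuous fun p : I × (Fin n → I) => (ρ p.2 i) :=
          (continuous_apply i).comp (hρ.comp continuous_snd)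
        fun_prop
      · intro u; simp only [mixI_zero]; rfl
      · intro u; simp only [mixI_one]; rfl
      · intro t u hu
        show f _ = f u
        rw [GenLoop.boundary f u hu]
        apply f.2
        obtain ⟨i, hi⟩ := hu
        refine ⟨i, ?_⟩
        rcases hi with hi | hi
        · left; simp only [ρ, hi, stretchI_zero, mixI_same]
        · right; simp only [ρ, hi, stretchI_one, mixI_same]
    have e2 : GenLoop.Homotopic K M := by
      refine ⟨⟨⟨⟨fun p => c (f (ρ p.2)) (max p.1 (d p.2)), ?_⟩, ?_, ?_⟩, ?_⟩⟩
      · exact hc.comp ((hfc.comp (hρ.comp continuous_snd)).prodMk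
          (continuous_fst.max (hd.comp continuous_snd)))
      · intro u
        show c (f (ρ u)) (max 0 (d u)) = c x (d u)
        rw [max_eq_right unitInterval.nonneg']
        by_cases hu : d u = 0
        · rw [hu, h0, h0]
        · rw [GenLoop.boundary f _ (hρd u hu)]
      · intro u
        show c (f (ρ u)) (max 1 (d u)) = f (ρ u)
        rw [max_eq_left unitInterval.le_one', h1]
      · intro t u hu
        show c (f (ρ u)) (max t (d u)) = c x (d u)
        rw [hdb u hu, max_eq_right unitInterval.le_one', GenLoop.boundary f _ (hρb u hu)]
    exact e1.trans e2.symm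
  refine ⟨fun a b => ?_⟩
  induction a using Quotient.inductionOn with | _ f =>
  induction b using Quotient.inductionOn with | _ g =>
  exact Quotient.sound ((key f).trans (key g).symm)


/-- the map `[1] ⟶ [n]` sending `0` to `0` and `1` to the last vertex. -/
def endsHom (n : SimplexCategory) : (⦋1⦌ : SimplexCategory) ⟶ n :=
  SimplexCategory.Hom.mk ⟨fun i => if i = 0 then 0 else Fin.last _, by
    intro i j hij
    show (if i = 0 then (0 : Fin (n.len+1)) else Fin.last _) ≤ if j = 0 then 0 else Fin.last _
    by_cases h1 : i = 0
    · rw [if_pos h1]; exact Fin.zero_le _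
    · have h2 : j ≠ 0 := fun h2 => h1 (le_antisymm (h2 ▸ hij) (Fin.zero_le _))
      rw [if_neg h1, if_neg h2]⟩

lemma endsHom_idem {n : SimplexCategory} (τ : n ⟶ ⦋1⦌) : τ ≫ endsHom n ≫ τ = τ := by
  ext i : 3
  have hm : Monotone τ.toOrderHom := τ.toOrderHom.monotone
  have h1 : ∀ j : Fin 2, j = 0 ∨ j = 1 := by decide
  show τ.toOrderHom ((endsHom n).toOrderHom (τ.toOrderHom i)) = τ.toOrderHom i
  have e0 : (endsHom n).toOrderHom 0 = 0 := rfl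
  have e1 : (endsHom n).toOrderHom 1 = Fin.last _ := rfl
  rcases h1 (τ.toOrderHom i) with h | h
  · rw [h]
    exact le_antisymm ((hm (Fin.zero_le i)).trans h.le) (Fin.zero_le _)
  · rw [h]
    exact le_antisymm (Fin.le_last _) (h.symm.le.trans (hm (Fin.le_last i)))

lemma endsHom_one : endsHom ⦋1⦌ = 𝟙 _ := by
  ext i : 3
  revert i
  show ∀ i : Fin 2, (if i = 0 then 0 else Fin.last 1) = i
  decide

lemma end_one_cases (β : (⦋1⦌ : SimplexCategory) ⟶ ⦋1⦌) :
    β = 𝟙 _ ∨ (∀ i, β.toOrderHom i = 0) ∨ (∀ i, β.toOrderHom i = 1) := by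
  have hm : β.toOrderHom 0 ≤ β.toOrderHom 1 := β.toOrderHom.monotone (Fin.zero_le _)
  have h1 : ∀ j : Fin 2, j = 0 ∨ j = 1 := by decide
  have h2 : ∀ (P : Fin 2 → Prop), P 0 → P 1 → ∀ i, P i := fun P a b i => by
    rcases h1 i with h | h <;> rw [h] <;> assumption
  rcases h1 (β.toOrderHom 0) with h | h <;> rcases h1 (β.toOrderHom 1) with h' | h'
  · exact Or.inr (Or.inl (h2 _ h h'))
  · left
    ext i : 3
    exact h2 (fun i => β.toOrderHom i = i) h h' i
  · rw [h, h'] at hm; exact absurd hm (by decide)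
  · exact Or.inr (Or.inr (h2 _ h h'))

/-- Maps out of a one-dimensional simplicial set. -/
theorem exists_sset_map (N S : SSet.{0}) (θ : ∀ n : SimplexCategory, N.obj (op n) → (n ⟶ ⦋1⦌))
    (hnat : ∀ (m n : SimplexCategory) (α : m ⟶ n) (x : N.obj (op n)),
      θ m (N.map α.op x) = α ≫ θ n x)
    (hθ : ∀ (n : SimplexCategory) (x : N.obj (op n)),
      N.map (θ n x).op (N.map (endsHom n).op x) = x)
    (Q : N.obj (op ⦋1⦌) → S.obj (op ⦋1⦌))
    (hQ : ∀ (β : (⦋1⦌ : SimplexCategory) ⟶ ⦋1⦌) y, Q (N.map β.op y) = S.map β.op (Q y)) :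
    ∃ φ : N ⟶ S, ∀ y, φ.app (op ⦋1⦌) y = Q y := by
  refine ⟨⟨fun n => ↾fun x => S.map (θ n.unop x).op (Q (N.map (endsHom n.unop).op x)), ?_⟩, ?_⟩
  · rintro ⟨n⟩ ⟨m⟩ ⟨α⟩
    ext x
    change m ⟶ n at α
    show S.map (θ m (N.map α.op x)).op (Q (N.map (endsHom m).op (N.map α.op x)))
      = S.map α.op (S.map (θ n x).op (Q (N.map (endsHom n).op x)))
    rw [hnat]
    have hx := hθ n x
    set y := N.map (endsHom n).op x with hy
    have : N.map (endsHom m).op (N.map α.op x) = N.map (endsHom m ≫ α ≫ θ n x).op y := by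
      conv_lhs => rw [← hx]
      simp only [op_comp, Functor.map_comp]
      rfl
    rw [this, hQ]
    have e := endsHom_idem (α ≫ θ n x)
    have e2 : ∀ z, S.map (α ≫ θ n x).op (S.map (endsHom m ≫ α ≫ θ n x).op z)
      = S.map ((α ≫ θ n x) ≫ endsHom m ≫ α ≫ θ n x).op z := by
      intro z
      rw [show ((α ≫ θ n x) ≫ endsHom m ≫ α ≫ θ n x).op
        = (endsHom m ≫ α ≫ θ n x).op ≫ (α ≫ θ n x).op from rfl, Functor.map_comp]; rfl
    rw [e2, e, op_comp, Functor.map_comp]; rfl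
  · intro y
    show S.map (θ _ y).op (Q (N.map (endsHom ⦋1⦌).op y)) = Q y
    have h := hθ _ y
    have e : N.map (endsHom ⦋1⦌).op y = y := by
      rw [endsHom_one]
      exact ConcreteCategory.congr_hom (N.map_id _) y
    rw [e] at h ⊢
    rw [← hQ, h]

theorem sset_map_ext (N S : SSet.{0}) (θ : ∀ n : SimplexCategory, N.obj (op n) → (n ⟶ ⦋1⦌))
    (hθ : ∀ (n : SimplexCategory) (x : N.obj (op n)),
      N.map (θ n x).op (N.map (endsHom n).op x) = x)
    (φ ψ : N ⟶ S) (h : ∀ y, φ.app (op ⦋1⦌) y = ψ.app (op ⦋1⦌) y) : φ = ψ := by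
  ext ⟨n⟩ x
  rw [← hθ n x]
  have e1 : ∀ y, φ.app (op n) (N.map (θ n x).op y) = S.map (θ n x).op (φ.app _ y) :=
    fun y => ConcreteCategory.congr_hom (φ.naturality (θ n x).op) y
  have e2 : ∀ y, ψ.app (op n) (N.map (θ n x).op y) = S.map (θ n x).op (ψ.app _ y) :=
    fun y => ConcreteCategory.congr_hom (ψ.naturality (θ n x).op) y
  exact (e1 _).trans ((congrArg _ (h _)).trans (e2 _).symm)

def thetaNerve {C : Type} [Category.{0} C] (ht : C → Fin 2)
    (hle : ∀ a b : C, (a ⟶ b) → ht a ≤ ht b) (n : SimplexCategory) (x : (nerve C).obj (op n)) : n ⟶ ⦋1⦌ :=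
  SimplexCategory.Hom.mk ⟨fun i => ht (CategoryTheory.Functor.obj x i), fun _ _ hij =>
    hle _ _ (CategoryTheory.Functor.map x (homOfLE hij))⟩

theorem thetaNerve_spec {C : Type} [Category.{0} C] (ht : C → Fin 2)
    (hle : ∀ a b : C, (a ⟶ b) → ht a ≤ ht b)
    (hid : ∀ (a b : C) (f : a ⟶ b), ht a = ht b → ∃ h : a = b, f = eqToHom h) (n : SimplexCategory) (x : (nerve C).obj (op n)) :
    (nerve C).map (thetaNerve ht hle n x).op ((nerve C).map (endsHom n).op x) = x := by
  change ComposableArrows C n.len at x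
  have h1 : ∀ j : Fin 2, j = 0 ∨ j = 1 := by decide
  let ρ : Fin (n.len + 1) →o Fin (n.len + 1) :=
    (endsHom n).toOrderHom.comp (thetaNerve ht hle n x).toOrderHom
  have hρ : ∀ i, ht (x.obj (ρ i)) = ht (x.obj i) := by
    intro i
    rcases h1 (ht (x.obj i)) with h | h
    · have : ρ i = 0 := by
        show (endsHom n).toOrderHom (ht (x.obj i)) = 0
        rw [h]; rfl
      rw [this, h]
      exact le_antisymm ((hle _ _ (x.map (homOfLE (Fin.zero_le i)))).trans h.le) (Fin.zero_le _)
    · have : ρ i = Fin.last _ := by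
        show (endsHom n).toOrderHom (ht (x.obj i)) = _
        rw [h]; rfl
      rw [this, h]
      exact le_antisymm (Fin.le_last _)
        (h.symm.le.trans (hle _ _ (x.map (homOfLE (Fin.le_last i)))))
  have hobj : ∀ i, x.obj (ρ i) = x.obj i := by
    intro i
    rcases le_total (ρ i) i with h | h
    · exact (hid _ _ (x.map (homOfLE h)) (hρ i)).1
    · exact (hid _ _ (x.map (homOfLE h)) (hρ i).symm).1.symm
  have hmor : ∀ i j (h : i ≤ j), ht (x.obj i) = ht (x.obj j) → ∃ h' , x.map (homOfLE h) = eqToHom h' :=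
    fun i j h h' => hid _ _ _ h'
  refine CategoryTheory.Functor.ext (F := (monotone_iff_forall_lt.2 fun a b h => ρ.monotone h.le : Monotone ρ).functor ⋙ x) (G := x) hobj ?_
  intro i j f
  have hij : i ≤ j := leOfHom f
  obtain rfl : f = homOfLE hij := Subsingleton.elim _ _
  show x.map (homOfLE (ρ.monotone hij)) =
    eqToHom (hobj i) ≫ x.map (homOfLE hij) ≫ eqToHom (hobj j).symm
  by_cases he : ht (x.obj i) = ht (x.obj j)
  · obtain ⟨h1, h2⟩ := hmor i j hij he
    obtain ⟨h3, h4⟩ := hmor (ρ i) (ρ j) (ρ.monotone hij) (by rw [hρ, hρ, he])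
    rw [h2, h4]; simp
  · have hlt : ht (x.obj i) ≤ ht (x.obj j) := hle _ _ (x.map (homOfLE hij))
    have hi0 : ht (x.obj i) = 0 := by
      rcases h1 (ht (x.obj i)) with h | h
      · exact h
      · exact absurd (le_antisymm hlt (by rw [h]; exact Fin.le_last _)) he
    have hj1 : ht (x.obj j) = 1 := by
      rcases h1 (ht (x.obj j)) with h | h
      · exact absurd (by rw [h, hi0]) he
      · exact h
    have ri : ρ i = 0 := by
      show (endsHom n).toOrderHom (ht (x.obj i)) = _
      rw [hi0]; rfl
    have rj : ρ j = Fin.last _ := by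
      show (endsHom n).toOrderHom (ht (x.obj j)) = _
      rw [hj1]; rfl
    have li : ρ i ≤ i := by rw [ri]; exact Fin.zero_le _
    have lj : j ≤ ρ j := by rw [rj]; exact Fin.le_last _
    obtain ⟨a1, a2⟩ := hmor (ρ i) i li (hρ i)
    obtain ⟨b1, b2⟩ := hmor j (ρ j) lj (hρ j).symm
    have : homOfLE (ρ.monotone hij) = homOfLE li ≫ homOfLE hij ≫ homOfLE lj := Subsingleton.elim _ _
    rw [this, Functor.map_comp, Functor.map_comp, a2, b2]

noncomputable def simplexI : C(stdSimplex ℝ (Fin 2), I) :=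
  ⟨stdSimplexHomeomorphUnitInterval, stdSimplexHomeomorphUnitInterval.continuous⟩

lemma simplexI_map_const (β : Fin 2 → Fin 2) (j : Fin 2) (h : ∀ i, β i = j)
    (z : stdSimplex ℝ (Fin 2)) :
    simplexI (stdSimplex.map β z) = simplexI (stdSimplex.vertex j) := by
  have : stdSimplex.map β z = stdSimplex.vertex j := by
    ext k
    have hz : z.1 0 + z.1 1 = 1 := by simpa using z.2.2
    simp [FunOnFinite.linearMap_apply_apply, h, Pi.single_apply]
    by_cases hk : j = k
    · simp [hk]
    · simp [hk, Ne.symm hk]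
  rw [this]


/-- the characteristic map of a one simplex -/
noncomputable def charMap (N : SSet.{0}) (n : SimplexCategory) (y : N.obj (op n)) :
    C(stdSimplex ℝ (Fin (n.len + 1)), SSet.toTop.obj N) :=
  TopCat.toSSetObjEquiv _ _ ((sSetTopAdj.unit.app N).app (op n) y)

lemma charMap_map (N : SSet.{0}) {m n : SimplexCategory} (α : m ⟶ n) (y : N.obj (op n)) (z) :
    charMap N m (N.map α.op y) z = charMap N n y (stdSimplex.map α.toOrderHom z) := by
  have := ConcreteCategory.congr_hom ((sSetTopAdj.unit.app N).naturality α.op) y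
  unfold charMap
  exact congrArg (fun w => TopCat.toSSetObjEquiv _ _ w z) this

lemma transpose_charMap (N : SSet.{0}) (Z : TopCat.{0}) (φ : N ⟶ TopCat.toSSet.obj Z)
    (n : SimplexCategory) (y : N.obj (op n)) (z) :
    (sSetTopAdj.homEquiv N Z).symm φ (charMap N n y z) =
      TopCat.toSSetObjEquiv _ _ (φ.app (op n) y) z := by
  have h := (sSetTopAdj.homEquiv N Z).apply_symm_apply φ
  rw [Adjunction.homEquiv_unit] at h
  conv_rhs => rw [← h]
  rfl

section
variable {C : Type} [Category.{0} C]

/-- vertices of the realization -/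
noncomputable def nervePt (a : C) : SSet.toTop.obj (nerve C) :=
  charMap (nerve C) ⦋0⦌ (ComposableArrows.mk₀ a) (stdSimplex.vertex 0)

noncomputable def unitSimplex : C(I, stdSimplex ℝ (Fin 2)) :=
  ⟨stdSimplexHomeomorphUnitInterval.symm, stdSimplexHomeomorphUnitInterval.symm.continuous⟩

lemma unitSimplex_zero : unitSimplex 0 = stdSimplex.vertex 0 := by
  rw [← stdSimplexHomeomorphUnitInterval_zero]
  exact stdSimplexHomeomorphUnitInterval.symm_apply_apply _
lemma unitSimplex_one : unitSimplex 1 = stdSimplex.vertex 1 := by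
  rw [← stdSimplexHomeomorphUnitInterval_one]
  exact stdSimplexHomeomorphUnitInterval.symm_apply_apply _
lemma simplexI_unitSimplex (t : I) : simplexI (unitSimplex t) = t :=
  stdSimplexHomeomorphUnitInterval.apply_symm_apply _
lemma unitSimplex_simplexI (z) : unitSimplex (simplexI z) = z :=
  stdSimplexHomeomorphUnitInterval.symm_apply_apply _

lemma charMap_vertex (n : SimplexCategory) (x : (nerve C).obj (op n)) (i : Fin (n.len + 1)) :
    charMap (nerve C) n x (stdSimplex.vertex i) = nervePt (CategoryTheory.Functor.obj x i) := by
  have h := charMap_map (nerve C) (SimplexCategory.const ⦋0⦌ n i) x (stdSimplex.vertex 0)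
  rw [stdSimplex.map_vertex] at h
  refine Eq.trans ?_ (h.symm.trans ?_)
  · rfl
  · unfold nervePt
    congr 2
    exact ComposableArrows.ext₀ rfl

/-- paths in the realization -/
noncomputable def nervePath {a b : C} (f : a ⟶ b) : Path (nervePt a) (nervePt b) where
  toFun t := charMap (nerve C) ⦋1⦌ (ComposableArrows.mk₁ f) (unitSimplex t)
  continuous_toFun := by fun_prop
  source' := by rw [unitSimplex_zero]; exact charMap_vertex _ _ _
  target' := by rw [unitSimplex_one]; exact charMap_vertex _ _ _

lemma nervePath_id (a : C) : nervePath (𝟙 a) = Path.refl _ := by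
  ext t
  have h := charMap_map (nerve C) (SimplexCategory.const ⦋1⦌ ⦋0⦌ 0) (ComposableArrows.mk₀ a) (unitSimplex t)
  refine Eq.trans ?_ (h.trans ?_)
  · show charMap _ _ _ _ = _
    congr 2
    exact ComposableArrows.ext₁ rfl rfl (show 𝟙 a = 𝟙 a ≫ 𝟙 a ≫ 𝟙 a by simp)
  · show _ = charMap (nerve C) ⦋0⦌ (ComposableArrows.mk₀ a) (stdSimplex.vertex 0)
    congr 1
    exact Subsingleton.elim (α := stdSimplex ℝ (Fin 1)) _ _

structure OneDim (C : Type) [Category.{0} C] (ht : C → Fin 2) : Prop where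
  hle : ∀ a b : C, (a ⟶ b) → ht a ≤ ht b
  hid : ∀ (a b : C) (f : a ⟶ b), ht a = ht b → ∃ h : a = b, f = eqToHom h

theorem exists_map_of_paths {ht : C → Fin 2} (hC : OneDim C ht) {Z : Type} [TopologicalSpace Z]
    (q : C → Z) (Q : ∀ {a b : C} (_ : a ⟶ b), Path (q a) (q b))
    (hQ : ∀ a, Q (𝟙 a) = Path.refl _) :
    ∃ Φ : C(SSet.toTop.obj (nerve C), Z), ∀ {a b : C} (f : a ⟶ b) t, Φ (nervePath f t) = Q f t := by
  let R (y : ComposableArrows C 1) : C(stdSimplex ℝ (Fin 2), Z) :=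
    ⟨fun z => Q (y.map (homOfLE (Fin.zero_le 1))) (simplexI z), by fun_prop⟩
  obtain ⟨φ, hφ⟩ := exists_sset_map (nerve C) (TopCat.toSSet.obj (TopCat.of Z))
    (thetaNerve ht hC.hle) (fun _ _ _ _ => rfl) (thetaNerve_spec ht hC.hle hC.hid)
    (fun y => (TopCat.toSSetObjEquiv (TopCat.of Z) (op ⦋1⦌)).symm (R y)) (by
      intro β y
      change ComposableArrows C 1 at y
      refine Eq.trans ?_ (TopCat.toSSetObjEquiv_symm_naturality (X := TopCat.of Z) β (R y)).symm
      congr 1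
      ext z
      show R ((nerve C).map β.op y) z = R y (stdSimplex.map β.toOrderHom z)
      have h01 : (β.toOrderHom 0 : Fin 2) ≤ β.toOrderHom 1 := β.toOrderHom.monotone (Fin.zero_le _)
      show Q (y.map (homOfLE h01)) (simplexI z) = Q (y.map (homOfLE (Fin.zero_le 1))) (simplexI (stdSimplex.map β.toOrderHom z))
      have hconst : ∀ (i j k : Fin 2) (h : i ≤ j) (_ : i = k) (_ : j = k) t, Q (y.map (homOfLE h)) t = q (y.obj k) := by
        rintro i j k h rfl rfl t
        have : homOfLE h = 𝟙 j := Subsingleton.elim _ _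
        rw [this, y.map_id, hQ]; rfl
      rcases end_one_cases β with rfl | h | h
      · have : stdSimplex.map (SimplexCategory.Hom.toOrderHom (𝟙 (⦋1⦌ : SimplexCategory))) z = z :=
          stdSimplex.map_id_apply z
        rw [this]; rfl
      · rw [hconst _ _ 0 h01 (h 0) (h 1), simplexI_map_const _ 0 h]
        exact ((Q _).source).symm
      · rw [hconst _ _ 1 h01 (h 0) (h 1), simplexI_map_const _ 1 h]
        exact ((Q _).target).symm)
  refine ⟨((sSetTopAdj.homEquiv _ (TopCat.of Z)).symm φ).hom, ?_⟩
  intro a b f t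
  refine (transpose_charMap (nerve C) (TopCat.of Z) φ ⦋1⦌ (ComposableArrows.mk₁ f) (unitSimplex t)).trans ?_
  refine (congrArg (fun w => TopCat.toSSetObjEquiv (TopCat.of Z) (op ⦋1⦌) w (unitSimplex t))
    (hφ (ComposableArrows.mk₁ f))).trans ?_
  rw [Equiv.apply_symm_apply]
  show Q _ (simplexI (unitSimplex t)) = _
  rw [simplexI_unitSimplex]
  rfl

theorem map_ext_of_paths {ht : C → Fin 2} (hC : OneDim C ht) {Z : Type} [TopologicalSpace Z]
    (Φ Ψ : C(SSet.toTop.obj (nerve C), Z))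
    (h : ∀ {a b : C} (f : a ⟶ b) t, Φ (nervePath f t) = Ψ (nervePath f t)) : Φ = Ψ := by
  have : TopCat.ofHom Φ = TopCat.ofHom (Y := Z) Ψ := by
    apply (sSetTopAdj.homEquiv (nerve C) (TopCat.of Z)).injective
    apply sset_map_ext _ _ _ (thetaNerve_spec ht hC.hle hC.hid)
    intro y
    apply (TopCat.toSSetObjEquiv (TopCat.of Z) (op ⦋1⦌)).injective
    ext z
    rw [Adjunction.homEquiv_unit, Adjunction.homEquiv_unit]
    change ComposableArrows C 1 at y
    show Φ (charMap (nerve C) ⦋1⦌ y z) = Ψ (charMap (nerve C) ⦋1⦌ y z)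
    have hy : y = ComposableArrows.mk₁ (y.map (homOfLE (Fin.zero_le 1))) :=
      ComposableArrows.ext₁ rfl rfl (show y.hom = 𝟙 _ ≫ y.map (homOfLE (Fin.zero_le 1)) ≫ 𝟙 _ by
        rw [Category.id_comp, Category.comp_id])
    have := h (y.map (homOfLE (Fin.zero_le 1))) (simplexI z)
    simp only [nervePath, Path.coe_mk', ContinuousMap.coe_mk, unitSimplex_simplexI] at this
    rw [hy]
    exact this
  exact congrArg TopCat.Hom.hom this
end

/-- doubling and truncating the time parameter -/
noncomputable def dblI (t : I) : I := Set.projIcc 0 1 zero_le_one (2 * (t : ℝ))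
noncomputable def contrS (s t : I) : I :=
  Set.projIcc 0 1 zero_le_one ((s : ℝ) * min 1 (2 - 2 * (t : ℝ)))
noncomputable def contrT (s t : I) : I :=
  Set.projIcc 0 1 zero_le_one (min (t : ℝ) (1/2) * (1 + s))

lemma continuous_dblI : Continuous dblI := by
  unfold dblI; fun_prop

lemma projI_of_mem {x : ℝ} (h : x ∈ Set.Icc (0:ℝ) 1) :
    Set.projIcc (0:ℝ) 1 zero_le_one x = (⟨x, h⟩ : I) := Set.projIcc_of_mem _ h

lemma exists_contr_path {Y : Type} [TopologicalSpace Y] {r a b : Y} (p : Path r a) (p' : Path r b)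
    (g : Path a b) (F : Path.Homotopy (p.trans g) p') :
    ∃ H : I → I → Y, Continuous (fun z : I × I => H z.1 z.2) ∧
      (∀ t, H 0 t = p (dblI t)) ∧ (∀ t, H 1 t = p' (dblI t)) ∧
      (∀ s, H s 0 = r) ∧ (∀ s, H s 1 = g s) := by
  refine ⟨fun s t => F (contrS s t, contrT s t), ?_, ?_, ?_, ?_, ?_⟩
  · apply F.continuous.comp
    unfold contrS contrT
    fun_prop
  · intro t
    have h1 : contrS 0 t = 0 := by simp [contrS]
    have ht := t.2
    have h2 : min (t : ℝ) (1/2) * (1 + ((0 : I) : ℝ)) = min (t:ℝ) (1/2) := by simp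
    show F (contrS 0 t, contrT 0 t) = _
    rw [h1, F.apply_zero]
    unfold contrT
    rw [h2, projI_of_mem ⟨le_min ht.1 (by norm_num), (min_le_left _ _).trans ht.2⟩]
    show (p.trans g) _ = _
    rw [Path.trans_apply, dif_pos (show min (t:ℝ) (1/2) ≤ 1/2 from min_le_right _ _)]
    congr 1
    unfold dblI
    rcases le_total (t:ℝ) (1/2) with h | h
    · rw [projI_of_mem ⟨by linarith [ht.1], by linarith⟩]
      apply Subtype.ext
      show 2 * min (t:ℝ) (1/2) = _
      rw [min_eq_left h]
    · rw [Set.projIcc_of_right_le _ (by linarith)]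
      apply Subtype.ext
      show 2 * min (t:ℝ) (1/2) = 1
      rw [min_eq_right h]; norm_num
  · intro t
    show F (contrS 1 t, contrT 1 t) = _
    have ht := t.2
    rcases le_total (t:ℝ) (1/2) with h | h
    · have h1 : contrS 1 t = 1 := by
        unfold contrS
        rw [Set.projIcc_of_right_le]; · rfl
        rw [min_eq_left (by linarith)]; simp
      have h2 : contrT 1 t = dblI t := by
        unfold contrT dblI
        congr 1
        rw [min_eq_left h]; simp; ring
      rw [h1, h2, F.apply_one]; rfl
    · have h2 : contrT 1 t = 1 := by
        unfold contrT
        rw [Set.projIcc_of_right_le]; · rfl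
        rw [min_eq_right h]; simp; norm_num
      have h3 : dblI t = 1 := by
        unfold dblI; rw [Set.projIcc_of_right_le]; · rfl
        linarith
      rw [h2, h3, p'.target, F.target]
  · intro s
    have h2 : contrT s 0 = 0 := by simp [contrT]
    show F (contrS s 0, contrT s 0) = _
    rw [h2, F.source]
  · intro s
    have hs := s.2
    have h1 : contrS s 1 = 0 := by simp [contrS]
    have h2 : (min ((1 : I) : ℝ) (1/2) * (1 + s)) = (1 + s)/2 := by
      rw [min_eq_right (by simp; norm_num)]; ring
    show F (contrS s 1, contrT s 1) = _
    rw [h1, F.apply_zero]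
    unfold contrT
    rw [h2, projI_of_mem ⟨by linarith [hs.1], by linarith [hs.2]⟩]
    show (p.trans g) _ = _
    rw [Path.trans_apply]
    split_ifs with h
    · have : (1 + (s:ℝ))/2 ≤ 1/2 := h
      have hs0 : s = 0 := Subtype.ext (le_antisymm (by show (s:ℝ) ≤ 0; linarith) hs.1)
      subst hs0
      rw [g.source]
      convert p.target using 2
      apply Subtype.ext; simp
    · congr 1
      apply Subtype.ext; simp; ring

theorem weaklyContractible_of_paths {C : Type} [Category.{0} C] {ht : C → Fin 2} (hC : OneDim C ht)
    (r : C) (c : ∀ a : C, Path.Homotopic.Quotient (nervePt r) (nervePt a))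
    (hc : ∀ {a b : C} (f : a ⟶ b),
      (c a).trans (Path.Homotopic.Quotient.mk (nervePath f)) = c b) :
    WeaklyContractible (nerve C) := by
  choose p hp using fun a => Path.Homotopic.Quotient.mk_surjective (c a)
  let q (a : C) : C(I, SSet.toTop.obj (nerve C)) := ⟨fun t => p a (dblI t),
    (p a).continuous.comp continuous_dblI⟩
  have key : ∀ (a b : C) (f : a ⟶ b), ∃ P : Path (q a) (q b),
      (∀ s, P s 0 = nervePt r) ∧ (∀ s, P s 1 = nervePath f s) ∧
      (∀ h : a = b, f = eqToHom h → ∀ s, P s = q a) := by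
    intro a b f
    by_cases hf : ∃ h : a = b, f = eqToHom h
    · obtain ⟨rfl, rfl⟩ := hf
      refine ⟨Path.refl _, ?_, ?_, ?_⟩
      · intro s
        show p a (dblI 0) = _
        have : dblI 0 = 0 := by simp [dblI]
        rw [this, (p a).source]
      · intro s
        show p a (dblI 1) = _
        have : dblI 1 = 1 := by
          unfold dblI; rw [Set.projIcc_of_right_le]; · rfl
          simp
        rw [this, (p a).target, eqToHom_refl, nervePath_id]; rfl
      · intro _ _ s; rfl
    · have h1 : Path.Homotopic ((p a).trans (nervePath f)) (p b) := by
        rw [← Path.Homotopic.Quotient.eq, Path.Homotopic.Quotient.mk_trans, hp, hp, hc]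
      obtain ⟨F⟩ := h1
      obtain ⟨H, hH, h0, h1, h2, h3⟩ := exists_contr_path _ _ _ F
      let H' : C(I × I, SSet.toTop.obj (nerve C)) := ⟨fun z => H z.1 z.2, hH⟩
      refine ⟨⟨H'.curry, ?_, ?_⟩, ?_, ?_, ?_⟩
      · ext t; exact h0 t
      · ext t; exact h1 t
      · intro s; exact h2 s
      · intro s; exact h3 s
      · intro h h'; exact absurd ⟨h, h'⟩ hf
  choose P hP0 hP1 hPid using key
  obtain ⟨Φ, hΦ⟩ := exists_map_of_paths hC q (fun {a b} f => P a b f) (by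
    intro a; exact Path.ext (funext fun s => hPid a a (𝟙 a) rfl rfl s))
  have e0 : ∀ y, Φ y 0 = nervePt r := by
    have := map_ext_of_paths hC
      (⟨fun y => Φ y 0, by fun_prop⟩ : C(SSet.toTop.obj (nerve C), SSet.toTop.obj (nerve C)))
      (ContinuousMap.const _ (nervePt r)) (by
        intro a b f t
        show Φ _ 0 = _
        rw [hΦ]; exact hP0 _ _ _ _)
    exact fun y => DFunLike.congr_fun this y
  have e1 : ∀ y, Φ y 1 = y := by
    have := map_ext_of_paths hC
      (⟨fun y => Φ y 1, by fun_prop⟩ : C(SSet.toTop.obj (nerve C), SSet.toTop.obj (nerve C)))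
      (ContinuousMap.id _) (by
        intro a b f t
        show Φ _ 1 = _
        rw [hΦ]; exact hP1 _ _ _ _)
    exact fun y => DFunLike.congr_fun this y
  exact ⟨⟨nervePt r⟩, fun n x => subsingleton_homotopyGroup (fun y t => Φ y t)
    (by fun_prop) (nervePt r) e0 e1 n x⟩

theorem simplyConnected_of_weaklyContractible {S : SSet.{0}} (h : WeaklyContractible S) :
    SimplyConnectedSpace (SSet.toTop.obj S) := by
  obtain ⟨⟨x0⟩, h⟩ := h
  rw [simply_connected_iff_loops_nullhomotopic]
  refine ⟨?_, ?_⟩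
  · rw [pathConnectedSpace_iff_zerothHomotopy]
    have := h 0 x0
    have e := (HomotopyGroup.pi0EquivZerothHomotopy (x := x0))
    exact ⟨⟨e.toFun (by exact Quotient.mk _ GenLoop.const)⟩, e.symm.injective.subsingleton⟩
  · intro x γ
    have := h 1 x
    have e := (HomotopyGroup.pi1EquivFundamentalGroup (x := x))
    have hs : Subsingleton (Path.Homotopic.Quotient x x) :=
      show Subsingleton (FundamentalGroup _ x) from e.symm.injective.subsingleton
    exact Path.Homotopic.Quotient.eq.1 (Subsingleton.elim _ _)

theorem const_of_connected {C : Type} [Category.{0} C] {ht : C → Fin 2} (hC : OneDim C ht)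
    [PathConnectedSpace (SSet.toTop.obj (nerve C))] (q : C → Bool)
    (hq : ∀ {a b : C} (_ : a ⟶ b), q a = q b) (a b : C) : q a = q b := by
  obtain ⟨Φ, hΦ⟩ := exists_map_of_paths hC q (fun {a b} f => (Path.refl (q a)).cast rfl (hq f).symm)
    (by intro a; rfl)
  have h : ∀ a, Φ (nervePt a) = q a := by
    intro a
    have := hΦ (𝟙 a) 0
    rw [(nervePath (𝟙 a)).source] at this
    exact this
  rw [← h a, ← h b]
  exact PreconnectedSpace.constant inferInstance Φ.continuous

theorem potential_of_simplyConnected {C : Type} [Category.{0} C] {ht : C → Fin 2}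
    (hC : OneDim C ht) (r : C)
    [SimplyConnectedSpace (SSet.toTop.obj (nerve C))] (w : ∀ {a b : C} (_ : a ⟶ b), ℤ)
    (hw : ∀ a : C, w (𝟙 a) = 0) : ∃ h : C → ℝ, ∀ {a b : C} (f : a ⟶ b), h b = h a + w f := by
  let π : ℝ → AddCircle (1:ℝ) := fun x => (x : AddCircle (1:ℝ))
  have cov : IsCoveringMap π := AddCircle.isCoveringMap_coe 1
  have hint : ∀ (x : ℝ) (k : ℤ), π (x + k) = π x := by
    intro x k
    show ((x + k : ℝ) : AddCircle (1:ℝ)) = x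
    rw [AddCircle.coe_add, add_eq_left, AddCircle.coe_eq_zero_iff]
    exact ⟨k, by simp⟩
  have hint0 : ∀ k : ℤ, π k = 0 := by
    intro k
    have := hint 0 k
    rw [zero_add] at this
    rw [this]; rfl
  let Q {a b : C} (f : a ⟶ b) : Path (0 : AddCircle (1:ℝ)) 0 :=
    { toFun := fun t => π (w f * t)
      continuous_toFun := cov.continuous.comp (by fun_prop)
      source' := by simp [π]
      target' := by simpa using hint0 (w f) }
  obtain ⟨Φ, hΦ⟩ := exists_map_of_paths hC (fun _ => (0 : AddCircle (1:ℝ))) (fun {a b} f => Q f)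
    (by intro a; ext t; show π _ = 0; rw [hw]; simp [π])
  have hpt : ∀ a, Φ (nervePt a) = 0 := by
    intro a
    have := hΦ (𝟙 a) 0
    rw [(nervePath (𝟙 a)).source, (Q (𝟙 a)).source] at this
    exact this
  let γ (a : C) : Path.Homotopic.Quotient (nervePt r) (nervePt a) :=
    Path.Homotopic.Quotient.mk (PathConnectedSpace.somePath _ _)
  let e0 : π ⁻¹' {Φ (nervePt r)} := ⟨0, by
    show π 0 = _
    rw [hpt]; rfl⟩
  let h (a : C) : π ⁻¹' {Φ (nervePt a)} := cov.monodromy ((γ a).map Φ) e0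
  refine ⟨fun a => (h a).1, ?_⟩
  intro a b f
  have h1 : γ b = (γ a).trans (Path.Homotopic.Quotient.mk (nervePath f)) := Subsingleton.elim _ _
  have h2 : (γ b).map Φ = ((γ a).map Φ).trans
      (Path.Homotopic.Quotient.mk ((nervePath f).map Φ.continuous)) := by
    rw [h1]
    obtain ⟨g, hg⟩ := Path.Homotopic.Quotient.mk_surjective (γ a)
    rw [← hg, ← Path.Homotopic.Quotient.mk_trans, ← Path.Homotopic.Quotient.mk_map,
      ← Path.Homotopic.Quotient.mk_map, ← Path.Homotopic.Quotient.mk_trans, Path.map_trans]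
  have h3 : h b = cov.monodromy
      (Path.Homotopic.Quotient.mk ((nervePath f).map Φ.continuous)) (h a) := by
    show cov.monodromy _ _ = _
    rw [h2, cov.monodromy_trans_apply]
  show (h b).1 = (h a).1 + w f
  rw [h3]
  have ha : π (h a).1 = 0 := (h a).2.trans (hpt a)
  let ey : π ⁻¹' {Φ (nervePt b)} := ⟨(h a).1 + w f, by
    show π _ = _
    rw [hint, ha, hpt]⟩
  let Γ : Path (h a).1 ey.1 :=
    { toFun := fun t => (h a).1 + w f * t
      continuous_toFun := by fun_prop
      source' := by simp
      target' := by simp [ey] }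
  have := cov.monodromy_eq_of_map_eq (γ := Path.Homotopic.Quotient.mk ((nervePath f).map Φ.continuous))
    (ex := h a) (ey := ey) (Path.Homotopic.Quotient.mk Γ) (by
      refine congrArg Path.Homotopic.Quotient.mk ?_
      refine Path.ext (funext fun t => ?_)
      show π ((h a).1 + w f * t) = Φ (nervePath f t)
      rw [hΦ]
      show π ((h a).1 + w f * t) = π (w f * t)
      have : π ((h a).1 + w f * t) = π (h a).1 + π (w f * t) := AddCircle.coe_add _ _ _
      rw [this, ha, zero_add])
  rw [this]

section GraphSide
variable {V E : Type} (src tgt : E → V)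

theorem graph_of_potentials [Nonempty V]
    (hconn : ∀ q : V → Bool, (∀ e, q (src e) = q (tgt e)) → ∀ u v, q u = q v)
    (hpot : ∀ e0 : E, ∃ h : V → ℝ, h (src e0) = h (tgt e0) + 1 ∧
      ∀ e, e ≠ e0 → h (src e) = h (tgt e)) :
    (SimpleGraph.fromRel fun v w => ∃ e, src e = v ∧ tgt e = w).IsTree ∧
        (∀ e, src e ≠ tgt e) ∧
        (∀ e e', e ≠ e' →
          ¬((src e = src e' ∧ tgt e = tgt e') ∨ (src e = tgt e' ∧ tgt e = src e'))) := by
  classical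
  have hloop : ∀ e, src e ≠ tgt e := by
    intro e he
    obtain ⟨h, h1, -⟩ := hpot e
    rw [he] at h1
    linarith
  have hmulti : ∀ e e', e ≠ e' →
      ¬((src e = src e' ∧ tgt e = tgt e') ∨ (src e = tgt e' ∧ tgt e = src e')) := by
    rintro e e' hne (⟨h1, h2⟩ | ⟨h1, h2⟩)
    · obtain ⟨h, h3, h4⟩ := hpot e'
      have := h4 e hne
      rw [h1, h2] at this
      linarith
    · obtain ⟨h, h3, h4⟩ := hpot e'
      have := h4 e hne
      rw [h1, h2] at this
      linarith
  refine ⟨⟨?_, ?_⟩, hloop, hmulti⟩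
  · rw [SimpleGraph.connected_iff]
    refine ⟨?_, inferInstance⟩
    intro u v
    set G := SimpleGraph.fromRel fun v w => ∃ e, src e = v ∧ tgt e = w with hG
    have := hconn (fun x => decide (G.Reachable u x)) (by
      intro e
      have hadj : G.Adj (src e) (tgt e) := by
        rw [hG, SimpleGraph.fromRel_adj]
        exact ⟨hloop e, Or.inl ⟨e, rfl, rfl⟩⟩
      have : G.Reachable u (src e) ↔ G.Reachable u (tgt e) :=
        ⟨fun h => h.trans hadj.reachable, fun h => h.trans hadj.symm.reachable⟩
      simp [this]) u v
    have h2 : decide (G.Reachable u u) = true := by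
      rw [decide_eq_true_iff]
    rw [h2] at this
    exact of_decide_eq_true this.symm
  · rw [SimpleGraph.isAcyclic_iff_forall_adj_isBridge]
    have key : ∀ e0 : E, ¬ ((SimpleGraph.fromRel fun v w => ∃ e, src e = v ∧ tgt e = w).deleteEdges
        {s(src e0, tgt e0)}).Reachable (src e0) (tgt e0) := by
      rintro e0 ⟨p⟩
      obtain ⟨h, h1, h2⟩ := hpot e0
      have hw : ∀ u v (_ : ((SimpleGraph.fromRel fun v w => ∃ e, src e = v ∧ tgt e = w).deleteEdges
        {s(src e0, tgt e0)}).Walk u v), h u = h v := by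
        intro u v p
        induction p with
        | nil => rfl
        | cons hadj p ih =>
          rw [← ih]
          rw [SimpleGraph.deleteEdges_adj, SimpleGraph.fromRel_adj] at hadj
          obtain ⟨⟨-, ⟨e, rfl, rfl⟩ | ⟨e, rfl, rfl⟩⟩, h3⟩ := hadj
          · apply h2
            rintro rfl
            exact h3 rfl
          · symm
            apply h2
            rintro rfl
            exact h3 Sym2.eq_swap
      have := hw _ _ p
      linarith
    intro v w hadj
    rw [SimpleGraph.fromRel_adj] at hadj
    rw [SimpleGraph.isBridge_iff]
    obtain ⟨-, ⟨e, rfl, rfl⟩ | ⟨e, rfl, rfl⟩⟩ := hadj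
    · exact key e
    · intro h
      apply key e
      rw [Sym2.eq_swap]
      exact h.symm

theorem section_of_tree
    (hT : (SimpleGraph.fromRel fun v w => ∃ e, src e = v ∧ tgt e = w).IsTree)
    (hloop : ∀ e, src e ≠ tgt e)
    (hmulti : ∀ e e', e ≠ e' →
          ¬((src e = src e' ∧ tgt e = tgt e') ∨ (src e = tgt e' ∧ tgt e = src e')))
    (P : V → Type) (T : ∀ e, P (src e) ≃ P (tgt e)) (r : V) (b : P r) :
    ∃ c : ∀ v, P v, ∀ e, T e (c (src e)) = c (tgt e) := by
  set G := SimpleGraph.fromRel fun v w => ∃ e, src e = v ∧ tgt e = w with hG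
  have huniq : ∀ e e', (src e = src e' ∧ tgt e = tgt e') → e = e' :=
    fun e e' h => by_contra fun hne => hmulti e e' hne (Or.inl h)
  have hopp : ∀ e e', (src e = tgt e' ∧ tgt e = src e') → False := by
    intro e e' h
    have : e = e' := by_contra fun hne => hmulti e e' hne (Or.inr h)
    subst this
    exact hloop e h.1
  have hτ : ∀ u v, G.Adj u v → ∃ f : P u → P v,
      (∀ e (h1 : src e = u) (h2 : tgt e = v) (x : P (src e)), f (h1 ▸ x) = h2 ▸ T e x) ∧
      (∀ e (h1 : tgt e = u) (h2 : src e = v) (x : P (tgt e)),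
        f (h1 ▸ x) = h2 ▸ (T e).symm x) := by
    intro u v hadj
    rw [hG, SimpleGraph.fromRel_adj] at hadj
    obtain ⟨-, ⟨e0, rfl, rfl⟩ | ⟨e0, rfl, rfl⟩⟩ := hadj
    · refine ⟨T e0, ?_, ?_⟩
      · intro e h1 h2 x
        obtain rfl := huniq e e0 ⟨h1, h2⟩
        rfl
      · intro e h1 h2
        exact (hopp e e0 ⟨h2, h1⟩).elim
    · refine ⟨(T e0).symm, ?_, ?_⟩
      · intro e h1 h2
        exact (hopp e e0 ⟨h1, h2⟩).elim
      · intro e h1 h2 x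
        obtain rfl := huniq e e0 ⟨h2, h1⟩
        rfl
  choose τ hτ1 hτ2 using hτ
  let tr : ∀ {u v : V}, G.Walk u v → P u → P v := fun {u v} p =>
    SimpleGraph.Walk.rec (motive := fun u v _ => P u → P v) (fun x => x)
      (fun h _ ih x => ih (τ _ _ h x)) p
  have tr_concat : ∀ {u v w : V} (p : G.Walk u v) (h : G.Adj v w) (x : P u),
      tr (p.concat h) x = τ _ _ h (tr p x) := by
    intro u v w p h x
    induction p with
    | nil => rfl
    | cons h' p ih => exact ih h _
  choose p hp _ using fun v => hT.existsUnique_path r v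
  refine ⟨fun v => tr (p v) b, ?_⟩
  intro e
  have hadj : G.Adj (src e) (tgt e) := by
    rw [hG, SimpleGraph.fromRel_adj]
    exact ⟨hloop e, Or.inl ⟨e, rfl, rfl⟩⟩
  by_cases h : src e ∈ (p (tgt e)).support
  · have := hT.isAcyclic.path_concat (hp _) (hp _) hadj h
    show T e (tr (p (src e)) b) = tr (p (tgt e)) b
    rw [this, tr_concat]
    exact (hτ1 _ _ hadj e rfl rfl _).symm
  · have h' := hT.isAcyclic.mem_support_of_ne_mem_support_of_adj_of_isPath (hp _) (hp _) hadj h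
    have := hT.isAcyclic.path_concat (hp _) (hp _) hadj.symm h'
    show T e (tr (p (src e)) b) = tr (p (tgt e)) b
    rw [this, tr_concat]
    have h3 := hτ2 _ _ hadj.symm e rfl rfl (tr (p (tgt e)) b)
    apply (T e).symm.injective
    rw [Equiv.symm_apply_apply]
    exact h3

end GraphSide

section Elements
variable {X : WalkingParallelPairᵒᵖ ⥤ Type}

/-- the object of the category of elements attached to an element -/
def elOb {j : WalkingParallelPair} (x : X.obj (op j)) : CostructuredArrow yoneda X :=
  CostructuredArrow.mk (yonedaEquiv.symm x)

def elElt (a : CostructuredArrow yoneda X) : X.obj (op a.left) := yonedaEquiv a.hom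

lemma elOb_elElt (a : CostructuredArrow yoneda X) : elOb (elElt a) = a := by
  unfold elOb elElt
  rw [Equiv.symm_apply_apply]
  exact (CostructuredArrow.eq_mk a).symm

lemma elElt_elOb {j : WalkingParallelPair} (x : X.obj (op j)) : elElt (elOb x) = x :=
  yonedaEquiv.apply_symm_apply x

lemma elHom_iff {j k : WalkingParallelPair} (φ : j ⟶ k) (y : X.obj (op j)) (x : X.obj (op k)) :
    yoneda.map φ ≫ yonedaEquiv.symm x = yonedaEquiv.symm y ↔ X.map φ.op x = y := by
  rw [← yonedaEquiv.apply_eq_iff_eq, Equiv.apply_symm_apply, ← yonedaEquiv_naturality,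
    Equiv.apply_symm_apply]

def elMor {j k : WalkingParallelPair} (φ : j ⟶ k) {y : X.obj (op j)} {x : X.obj (op k)}
    (h : X.map φ.op x = y) : elOb y ⟶ elOb x :=
  CostructuredArrow.homMk φ ((elHom_iff φ y x).2 h)

theorem elMor_elim {M : ∀ {a b : CostructuredArrow yoneda X} (_ : a ⟶ b), Prop}
    (hM : ∀ {j k : WalkingParallelPair} (φ : j ⟶ k) {y : X.obj (op j)} {x : X.obj (op k)}
      (h : X.map φ.op x = y), M (elMor φ h)) {a b : CostructuredArrow yoneda X} (f : a ⟶ b) :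
    M f := by
  obtain ⟨j, x, rfl⟩ : ∃ (j : _) (x : X.obj (op j)), elOb x = a := ⟨_, _, elOb_elElt a⟩
  obtain ⟨k, y, rfl⟩ : ∃ (k : _) (y : X.obj (op k)), elOb y = b := ⟨_, _, elOb_elElt b⟩
  have h := (elHom_iff f.left _ _).1 (CostructuredArrow.w f)
  exact hM f.left h

def elHt (a : CostructuredArrow yoneda X) : Fin 2 :=
  match a.left with
  | .zero => 0
  | .one => 1

lemma elMor_id {j : WalkingParallelPair} {x y : X.obj (op j)} (h : X.map (𝟙 j : j ⟶ j).op x = y) :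
    ∃ h' : elOb y = elOb x, elMor (𝟙 j) h = eqToHom h' := by
  obtain rfl : x = y := by rw [← h]; simp
  exact ⟨rfl, CostructuredArrow.hom_ext _ _ rfl⟩

theorem oneDim_el : OneDim (CostructuredArrow yoneda X) elHt where
  hle a b f := by
    revert f
    apply elMor_elim (M := fun {a b} _ => elHt a ≤ elHt b)
    intro j k φ y x h
    rcases φ with _ | _ | _
    · exact Fin.zero_le _
    · exact Fin.zero_le _
    · exact le_rfl
  hid a b f := by
    revert f
    apply elMor_elim (M := fun {a b} f => elHt a = elHt b → ∃ h : a = b, f = eqToHom h)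
    intro j k φ y x h hh
    rcases φ with _ | _ | _
    · exact absurd hh (by show ¬ ((0 : Fin 2) = 1); decide)
    · exact absurd hh (by show ¬ ((0 : Fin 2) = 1); decide)
    · exact elMor_id h

open Classical in
/-- cochain which is the indicator function of the target half of the edge `e0` -/
noncomputable def elW (e0 : X.obj (op WalkingParallelPair.one))
    {j k : WalkingParallelPair} (φ : WalkingParallelPairHom j k) (x : X.obj (op k)) : ℤ :=
  match j, k, φ, x with
  | _, _, .left, _ => 0
  | _, _, .right, x => if x = e0 then 1 else 0
  | _, _, .id _, _ => 0

theorem el_potential [SimplyConnectedSpace (SSet.toTop.obj (nerve (CostructuredArrow yoneda X)))]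
    (e0 : X.obj (op WalkingParallelPair.one)) :
    ∃ h : X.obj (op WalkingParallelPair.zero) → ℝ,
      h (X.map (Quiver.Hom.op (WalkingParallelPairHom.left :
        WalkingParallelPair.zero ⟶ WalkingParallelPair.one)) e0) =
      h (X.map (Quiver.Hom.op (WalkingParallelPairHom.right :
        WalkingParallelPair.zero ⟶ WalkingParallelPair.one)) e0) + 1 ∧
      ∀ e, e ≠ e0 → h (X.map (Quiver.Hom.op (WalkingParallelPairHom.left :
        WalkingParallelPair.zero ⟶ WalkingParallelPair.one)) e) =
      h (X.map (Quiver.Hom.op (WalkingParallelPairHom.right :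
        WalkingParallelPair.zero ⟶ WalkingParallelPair.one)) e) := by
  obtain ⟨h, hh⟩ := potential_of_simplyConnected (oneDim_el (X := X)) (elOb e0)
    (fun {a b} f => elW e0 f.left (elElt b)) (fun a => rfl)
  have hl : ∀ e, h (elOb e) = h (elOb (X.map (Quiver.Hom.op (WalkingParallelPairHom.left :
        WalkingParallelPair.zero ⟶ WalkingParallelPair.one)) e)) := by
    intro e
    have := hh (elMor (WalkingParallelPairHom.left :
        WalkingParallelPair.zero ⟶ WalkingParallelPair.one) (x := e) rfl)
    rw [this]
    have : elW e0 (WalkingParallelPairHom.left) (elElt (elOb e)) = 0 := rfl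
    show _ + ((elW e0 (WalkingParallelPairHom.left) (elElt (elOb e)) : ℤ) : ℝ) = _
    rw [this]; simp
  have hr : ∀ e, h (elOb e) = h (elOb (X.map (Quiver.Hom.op (WalkingParallelPairHom.right :
        WalkingParallelPair.zero ⟶ WalkingParallelPair.one)) e)) +
        ((elW e0 (WalkingParallelPairHom.right) e : ℤ) : ℝ) := by
    intro e
    have := hh (elMor (WalkingParallelPairHom.right :
        WalkingParallelPair.zero ⟶ WalkingParallelPair.one) (x := e) rfl)
    rw [elElt_elOb] at this
    exact this
  refine ⟨fun v => h (elOb v), ?_, ?_⟩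
  · show h (elOb _) = h (elOb _) + 1
    rw [← hl, hr]
    simp [elW]
  · intro e he
    show h (elOb _) = h (elOb _)
    rw [← hl, hr]
    simp [elW, he]

theorem el_connected [PathConnectedSpace (SSet.toTop.obj (nerve (CostructuredArrow yoneda X)))]
    (q : X.obj (op WalkingParallelPair.zero) → Bool)
    (hq : ∀ e, q (X.map (Quiver.Hom.op (WalkingParallelPairHom.left :
        WalkingParallelPair.zero ⟶ WalkingParallelPair.one)) e) =
      q (X.map (Quiver.Hom.op (WalkingParallelPairHom.right :
        WalkingParallelPair.zero ⟶ WalkingParallelPair.one)) e)) (u v) : q u = q v := by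
  let q' : ∀ {j : WalkingParallelPair} (_ : X.obj (op j)), Bool := fun {j} =>
    match j with
    | .zero => q
    | .one => fun e => q (X.map (Quiver.Hom.op (WalkingParallelPairHom.left :
        WalkingParallelPair.zero ⟶ WalkingParallelPair.one)) e)
  have := const_of_connected (oneDim_el (X := X)) (fun a => q' (elElt a)) (by
    intro a b f
    revert f
    apply elMor_elim (M := fun {a b} _ => q' (elElt a) = q' (elElt b))
    intro j k φ y x h
    rw [elElt_elOb, elElt_elOb]
    subst h
    rcases φ with _ | _ | _
    · rfl
    · exact (hq x).symm
    · exact congrArg q' (by simp; rfl)) (elOb u) (elOb v)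
  simp only [elElt_elOb] at this
  exact this

theorem el_contract (r : X.obj (op WalkingParallelPair.zero))
    (c : ∀ v : X.obj (op WalkingParallelPair.zero),
      Path.Homotopic.Quotient (nervePt (elOb r)) (nervePt (elOb v)))
    (hc : ∀ e : X.obj (op WalkingParallelPair.one),
      (c _).trans (Path.Homotopic.Quotient.mk (nervePath (elMor (WalkingParallelPairHom.left :
        WalkingParallelPair.zero ⟶ WalkingParallelPair.one) (x := e) rfl))) =
      (c _).trans (Path.Homotopic.Quotient.mk (nervePath (elMor (WalkingParallelPairHom.right :
        WalkingParallelPair.zero ⟶ WalkingParallelPair.one) (x := e) rfl)))) :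
    WeaklyContractible (nerve (CostructuredArrow yoneda X)) := by
  let c' : ∀ {j : WalkingParallelPair} (x : X.obj (op j)),
      Path.Homotopic.Quotient (nervePt (elOb r)) (nervePt (elOb x)) := fun {j} =>
    match j with
    | .zero => c
    | .one => fun e =>
      (c _).trans (Path.Homotopic.Quotient.mk (nervePath (elMor (WalkingParallelPairHom.left :
        WalkingParallelPair.zero ⟶ WalkingParallelPair.one) (x := e) rfl)))
  let d (a : CostructuredArrow yoneda X) :
      Path.Homotopic.Quotient (nervePt (elOb r)) (nervePt a) :=
    (elOb_elElt a) ▸ c' (elElt a)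
  have hd0 : ∀ {j : WalkingParallelPair} (x y : X.obj (op j)) (_ : y = x)
      (h : elOb y = elOb x), (h ▸ c' y : Path.Homotopic.Quotient (nervePt (elOb r))
        (nervePt (elOb x))) = c' x := by
    intro j x y hxy h
    subst hxy
    rfl
  have hd : ∀ {j : WalkingParallelPair} (x : X.obj (op j)), d (elOb x) = c' x :=
    fun x => hd0 x _ (elElt_elOb x) _
  refine weaklyContractible_of_paths (oneDim_el (X := X)) (elOb r) d ?_
  intro a b f
  revert f
  apply elMor_elim (M := fun {a b} f =>
    (d a).trans (Path.Homotopic.Quotient.mk (nervePath f)) = d b)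
  intro j k φ y x h
  rw [hd, hd]
  subst h
  rcases φ with _ | _ | _
  · rfl
  · exact (hc x).symm
  · obtain ⟨h1, h2⟩ := elMor_id (j := j) (x := x) rfl
    have h3 : X.map (𝟙 j : j ⟶ j).op x = x := by simp
    have h4 : ∀ (y : X.obj (op j)) (h : X.map (𝟙 j : j ⟶ j).op x = y),
        (c' y).trans (Path.Homotopic.Quotient.mk (nervePath (elMor (𝟙 j) h))) = c' x := by
      intro y h
      obtain ⟨h5, h6⟩ := elMor_id h
      obtain rfl : x = y := by rw [← h]; simp
      rw [h6, eqToHom_refl, nervePath_id, Path.Homotopic.Quotient.mk_refl]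
      simp
    exact h4 _ rfl

end Elements

/-- For a nonempty directed multigraph `G`, viewed as a presheaf `X`
on the walking parallel pair `V ⇉ E`, the nerve of its category of elements is
weakly contractible iff the underlying undirected graph of `G` is a tree (simple,
connected, acyclic) and `G` has no loops and no multiple edges. -/
theorem stmt_16 (X : WalkingParallelPairᵒᵖ ⥤ Type)
    (hne : Nonempty (X.obj (op WalkingParallelPair.zero))) :
    letI src := X.map (Quiver.Hom.op (WalkingParallelPairHom.left :
        WalkingParallelPair.zero ⟶ WalkingParallelPair.one))
    letI tgt := X.map (Quiver.Hom.op (WalkingParallelPairHom.right :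
        WalkingParallelPair.zero ⟶ WalkingParallelPair.one))
    (WeaklyContractible (nerve (CostructuredArrow yoneda X)) ↔
      ((SimpleGraph.fromRel fun v w => ∃ e, src e = v ∧ tgt e = w).IsTree ∧
        (∀ e, src e ≠ tgt e) ∧
        (∀ e e', e ≠ e' →
          ¬((src e = src e' ∧ tgt e = tgt e') ∨ (src e = tgt e' ∧ tgt e = src e'))))) := by
  let src := X.map (Quiver.Hom.op (WalkingParallelPairHom.left :
        WalkingParallelPair.zero ⟶ WalkingParallelPair.one))
  let tgt := X.map (Quiver.Hom.op (WalkingParallelPairHom.right :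
        WalkingParallelPair.zero ⟶ WalkingParallelPair.one))
  constructor
  · intro h
    have := simplyConnected_of_weaklyContractible h
    exact graph_of_potentials (fun e => src e) (fun e => tgt e) el_connected el_potential
  · rintro ⟨hT, hloop, hmulti⟩
    obtain ⟨r⟩ := hne
    let L (e) : Path.Homotopic.Quotient (nervePt (elOb (src e))) (nervePt (elOb e)) :=
      Path.Homotopic.Quotient.mk (nervePath (elMor (WalkingParallelPairHom.left :
        WalkingParallelPair.zero ⟶ WalkingParallelPair.one) (x := e) rfl))
    let R (e) : Path.Homotopic.Quotient (nervePt (elOb (tgt e))) (nervePt (elOb e)) :=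
      Path.Homotopic.Quotient.mk (nervePath (elMor (WalkingParallelPairHom.right :
        WalkingParallelPair.zero ⟶ WalkingParallelPair.one) (x := e) rfl))
    obtain ⟨c, hc⟩ := section_of_tree (fun e => src e) (fun e => tgt e) hT hloop hmulti
      (fun v => Path.Homotopic.Quotient (nervePt (elOb r)) (nervePt (elOb v)))
      (fun e =>
        { toFun := fun g => (g.trans (L e)).trans (R e).symm
          invFun := fun g => (g.trans (R e)).trans (L e).symm
          left_inv := fun g => by simp
          right_inv := fun g => by simp }) r (Path.Homotopic.Quotient.refl _)
    refine el_contract r c ?_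
    intro e
    have := hc e
    show (c (src e)).trans (L e) = (c (tgt e)).trans (R e)
    rw [← this]
    simp
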